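/- Let 𝒞 be a simply connected twin chamber system over a set I, let J ⊆ I with |J| ≤ 2, and let c = (c⁺, c⁻) be a chamber of Opp(𝒞). Let G = (c₀, …, c_k) be a closed gallery in Opp(𝒞) with c₀ = c = c_k such that the 𝒞₊-component of c_μ lies in R_J(c⁺) for all μ = 0, …, k. Then G is null-homotopic in Opp(𝒞). -/

import Mathlib

/-! ## Chamber systems, galleries, homotopy, and twin chamber systems -/

namespace TwinChamber

universe u v

variable {I : Type u} {C : Type v}

/-- Two chambers are `i`-adjacent for some `i ∈ J`. -/
def JAdj (adj : I → C → C → Prop) (J : Set I) (c d : C) : Prop := ∃ j ∈ J, adj j c d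

/-- Two chambers are adjacent if they are `i`-adjacent for some `i ∈ I`. -/
def Adj (adj : I → C → C → Prop) (c d : C) : Prop := ∃ i, adj i c d

/-- A gallery is a nonempty finite sequence of chambers in which consecutive chambers are
adjacent. -/
def IsGallery (adj : I → C → C → Prop) (l : List C) : Prop :=
  l ≠ [] ∧ l.Chain' (Adj adj)

/-- `d` lies in the `J`-residue of `c`: there is a `J`-gallery from `c` to `d`. -/
def InResidue (adj : I → C → C → Prop) (J : Set I) (c d : C) : Prop :=
  Relation.ReflTransGen (JAdj adj J) c d

/-- Two galleries are elementary homotopic if they coincide on an initial segment and a final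
segment, and the two intermediate subgalleries are `J`-galleries, with the same first and last
chambers, for some `J ⊆ I` with `|J| ≤ 2`. -/
def ElemHomotopic (adj : I → C → C → Prop) (G H : List C) : Prop :=
  ∃ (P M M' S : List C) (J : Set I),
    J.Finite ∧ J.ncard ≤ 2 ∧
    M ≠ [] ∧ M' ≠ [] ∧
    M.head? = M'.head? ∧ M.getLast? = M'.getLast? ∧
    M.Chain' (JAdj adj J) ∧ M'.Chain' (JAdj adj J) ∧
    G = P ++ M ++ S ∧ H = P ++ M' ++ S

/-- Two galleries are homotopic if they are connected by a finite chain of elementary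
homotopies. -/
def Homotopic (adj : I → C → C → Prop) : List C → List C → Prop :=
  Relation.ReflTransGen (ElemHomotopic adj)

/-- A closed gallery is null-homotopic if it is homotopic to the length-zero gallery at its
initial chamber. -/
def NullHomotopic (adj : I → C → C → Prop) (G : List C) : Prop :=
  ∃ c, G.head? = some c ∧ Homotopic adj G [c]

/-- A chamber system is connected if any two chambers are joined by a gallery. -/
def Connected (adj : I → C → C → Prop) : Prop :=
  ∀ c d : C, Relation.ReflTransGen (Adj adj) c d

/-- A chamber system is simply connected if it is connected and every closed gallery is
null-homotopic. -/
def SimplyConnected (adj : I → C → C → Prop) : Prop :=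
  Connected adj ∧
    ∀ G : List C, IsGallery adj G → G.head? = G.getLast? → NullHomotopic adj G

/-- The reduced gallery of a gallery: delete every chamber equal to its immediate
predecessor. -/
noncomputable def reduced (l : List C) : List C :=
  letI : DecidableEq C := Classical.decEq C
  l.destutter (· ≠ ·)

/-- A twin chamber system over `I`: a pair of chamber systems `(Cp, adjp)`, `(Cm, adjm)` over
`I` (each `adj i` an equivalence relation) together with a symmetric opposition relation `op`
between them, satisfying the axioms (TCS1)–(TCS4) for both signs. -/
structure TwinCS (I : Type u) : Type (max u (v + 1)) where
  /-- The positive chamber set. -/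
  Cp : Type v
  /-- The negative chamber set. -/
  Cm : Type v
  /-- `i`-adjacency on `Cp`. -/
  adjp : I → Cp → Cp → Prop
  /-- `i`-adjacency on `Cm`. -/
  adjm : I → Cm → Cm → Prop
  eqvp : ∀ i, Equivalence (adjp i)
  eqvm : ∀ i, Equivalence (adjm i)
  /-- The opposition relation between `Cp` and `Cm`. -/
  op : Cp → Cm → Prop
  tcs1p : ∀ (i j : I) (c d : Cp) (x y : Cm), adjp i c d → adjm j x y →
    op d x → op c x → op c y → op d y ∨ j = i
  tcs1m : ∀ (i j : I) (c d : Cm) (x y : Cp), adjm i c d → adjp j x y →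
    op x d → op x c → op y c → op y d ∨ j = i
  tcs2p : ∀ (i : I) (c d : Cp) (x : Cm), adjp i c d → op c x →
    ∃ y : Cm, adjm i x y ∧ op c y ∧ op d y
  tcs2m : ∀ (i : I) (c d : Cm) (x : Cp), adjm i c d → op x c →
    ∃ y : Cp, adjp i x y ∧ op y c ∧ op y d
  tcs3p : ∀ (c : Cp) (x y : Cm), op c x → op c y →
    Relation.ReflTransGen (fun u v => op c u ∧ op c v ∧ Adj adjm u v) x y
  tcs3pJ : ∀ (c : Cp) (J : Set I), J.Finite → J.ncard ≤ 2 → ∀ x y : Cm, op c x → op c y →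
    InResidue adjm J x y →
    Relation.ReflTransGen (fun u v => op c u ∧ op c v ∧ JAdj adjm J u v) x y
  tcs3m : ∀ (c : Cm) (x y : Cp), op x c → op y c →
    Relation.ReflTransGen (fun u v => op u c ∧ op v c ∧ Adj adjp u v) x y
  tcs3mJ : ∀ (c : Cm) (J : Set I), J.Finite → J.ncard ≤ 2 → ∀ x y : Cp, op x c → op y c →
    InResidue adjp J x y →
    Relation.ReflTransGen (fun u v => op u c ∧ op v c ∧ JAdj adjp J u v) x y
  tcs4p : ∀ c : Cp, ∃ ω : Cm → Cp,
    (∀ (i : I) (x y : Cm), adjm i x y → adjp i (ω x) (ω y)) ∧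
    (∀ x, op (ω x) x) ∧ (∀ x, op c x → ω x = c)
  tcs4m : ∀ c : Cm, ∃ ω : Cp → Cm,
    (∀ (i : I) (x y : Cp), adjp i x y → adjm i (ω x) (ω y)) ∧
    (∀ x, op x (ω x)) ∧ (∀ x, op x c → ω x = c)

/-- The chambers of `Opp(𝒞)`: pairs of opposite chambers. -/
def OppC (T : TwinCS.{u, v} I) : Type v := {p : T.Cp × T.Cm // T.op p.1 p.2}

/-- `i`-adjacency on `Opp(𝒞)`: componentwise `i`-adjacency. -/
def oppAdj (T : TwinCS.{u, v} I) : I → OppC T → OppC T → Prop :=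
  fun i u v => T.adjp i u.1.1 v.1.1 ∧ T.adjm i u.1.2 v.1.2

/-- A twin chamber system is simply connected if both of its halves are simply connected
chamber systems. -/
def TwinSC (T : TwinCS.{u, v} I) : Prop :=
  SimplyConnected T.adjp ∧ SimplyConnected T.adjm

/-- `Walk r a b l`: the list `a :: l` is a sequence of consecutively `r`-related elements that
ends in `b`. -/
inductive Walk (r : C → C → Prop) : C → C → List C → Prop
  | nil (a : C) : Walk r a a []
  | cons {a a' b : C} {l : List C} : r a a' → Walk r a' b l → Walk r a b (a' :: l)

namespace Walk

variable {r s : C → C → Prop} {a b c : C} {l m : List C}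

theorem append (h : Walk r a b l) (h' : Walk r b c m) : Walk r a c (l ++ m) := by
  induction h with
  | nil => exact h'
  | cons hr _ ih => exact .cons hr (ih h')

theorem single (h : r a b) : Walk r a b [b] := .cons h (.nil b)

theorem mono (hrs : ∀ a b, r a b → s a b) (h : Walk r a b l) : Walk s a b l := by
  induction h with
  | nil => exact .nil _
  | cons hr _ ih => exact .cons (hrs _ _ hr) ih

theorem isChain (h : Walk r a b l) : (a :: l).IsChain r := by
  induction h with
  | nil => exact List.isChain_singleton _
  | cons hr _ ih => exact List.isChain_cons_cons.2 ⟨hr, ih⟩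

theorem getLast?_eq (h : Walk r a b l) : (a :: l).getLast? = some b := by
  induction h with
  | nil => rfl
  | cons _ _ ih => rw [List.getLast?_cons_cons]; exact ih

theorem of_isChain (h : (a :: l).IsChain r) (hb : (a :: l).getLast? = some b) :
    Walk r a b l := by
  induction l generalizing a with
  | nil =>
    obtain rfl : a = b := by simpa using hb
    exact .nil _
  | cons a' l ih =>
    rw [List.isChain_cons_cons] at h
    rw [List.getLast?_cons_cons] at hb
    exact .cons h.1 (ih h.2 hb)

theorem of_append (h : Walk r a c (l ++ m)) : ∃ b, Walk r a b l ∧ Walk r b c m := by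
  induction l generalizing a with
  | nil => exact ⟨a, .nil a, h⟩
  | cons a' l ih =>
    cases h with
    | cons hr h =>
      obtain ⟨b, h₁, h₂⟩ := ih h
      exact ⟨b, .cons hr h₁, h₂⟩

theorem end_unique (h : Walk r a b l) (h' : Walk s a c l) : b = c :=
  Option.some_injective _ (h.getLast?_eq.symm.trans h'.getLast?_eq)

theorem reflTransGen (h : Walk r a b l) : Relation.ReflTransGen r a b := by
  induction h with
  | nil => exact .refl
  | cons hr _ ih => exact .head hr ih

end Walk

section Homotopy

variable {D : Type*} {adj : I → C → C → Prop} {adj' : I → D → D → Prop}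
  {J : Set I} {a b : C} {l l' m m' : List C} {G H : List C}

theorem Adj.jAdj_univ {c d : C} (h : Adj adj c d) : JAdj adj Set.univ c d :=
  let ⟨j, h⟩ := h
  ⟨j, Set.mem_univ j, h⟩

theorem ElemHomotopic.symm (h : ElemHomotopic adj G H) : ElemHomotopic adj H G := by
  obtain ⟨P, M, M', S, J, hf, hc, h₁, h₂, h₃, h₄, h₅, h₆, h₇, h₈⟩ := h
  exact ⟨P, M', M, S, J, hf, hc, h₂, h₁, h₃.symm, h₄.symm, h₆, h₅, h₈, h₇⟩

theorem Homotopic.symm (h : Homotopic adj G H) : Homotopic adj H G :=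
  have : Std.Symm (ElemHomotopic adj) := ⟨fun _ _ => ElemHomotopic.symm⟩
  Std.Symm.symm (r := Relation.ReflTransGen (ElemHomotopic adj)) _ _ h

theorem Homotopic.append (h : Homotopic adj G H) (P S : List C) :
    Homotopic adj (P ++ G ++ S) (P ++ H ++ S) := by
  refine Relation.ReflTransGen.lift (fun G => P ++ G ++ S) ?_ _ _ h
  rintro _ _ ⟨Q, M, M', R, J, hf, hc, h₁, h₂, h₃, h₄, h₅, h₆, rfl, rfl⟩
  exact ⟨P ++ Q, M, M', R ++ S, J, hf, hc, h₁, h₂, h₃, h₄, h₅, h₆, by simp, by simp⟩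

theorem Homotopic.append_right (h : Homotopic adj (a :: l) (a :: l')) (S : List C) :
    Homotopic adj (a :: (l ++ S)) (a :: (l' ++ S)) := by
  simpa using h.append [] S

theorem Homotopic.append_left {r : C → C → Prop} (hl : Walk r a b l)
    (h : Homotopic adj (b :: m) (b :: m')) :
    Homotopic adj (a :: (l ++ m)) (a :: (l ++ m')) := by
  induction hl with
  | nil => exact h
  | cons _ _ ih => simpa using (ih h).append [_] []

/-- A morphism of chamber systems preserves homotopy. -/
theorem Homotopic.map (f : C → D) (hf : ∀ i c d, adj i c d → adj' i (f c) (f d))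
    (h : Homotopic adj G H) : Homotopic adj' (G.map f) (H.map f) := by
  refine Relation.ReflTransGen.lift (List.map f) ?_ _ _ h
  rintro _ _ ⟨P, M, M', S, J, hfin, hc, h₁, h₂, h₃, h₄, h₅, h₆, rfl, rfl⟩
  have key : ∀ c d, JAdj adj J c d → JAdj adj' J (f c) (f d) :=
    fun c d ⟨j, hj, h⟩ => ⟨j, hj, hf j c d h⟩
  refine ⟨P.map f, M.map f, M'.map f, S.map f, J, hfin, hc, by simpa using h₁,
    by simpa using h₂, by simp [h₃], by simp [h₄], ?_, ?_, by simp, by simp⟩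
  · exact List.isChain_map_of_isChain f key h₅
  · exact List.isChain_map_of_isChain f key h₆

/-- Two `J`-galleries with the same end points are homotopic if `|J| ≤ 2`. -/
theorem Homotopic.of_walk (hf : J.Finite) (hc : J.ncard ≤ 2)
    (h : Walk (JAdj adj J) a b l) (h' : Walk (JAdj adj J) a b l') :
    Homotopic adj (a :: l) (a :: l') :=
  .single ⟨[], a :: l, a :: l', [], J, hf, hc, by simp, by simp, rfl,
    h.getLast?_eq.trans h'.getLast?_eq.symm, h.isChain, h'.isChain, by simp, by simp⟩

/-- An elementary homotopy replaces a `J`-gallery inside a gallery. -/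
theorem ElemHomotopic.exists_walk (hl : Walk (Adj adj) a b l)
    (h : ElemHomotopic adj (a :: l) H) :
    ∃ (P M M' S : List C) (J : Set I) (x y : C), J.Finite ∧ J.ncard ≤ 2 ∧
      Walk (Adj adj) a x P ∧ Walk (JAdj adj J) x y M ∧ Walk (JAdj adj J) x y M' ∧
      Walk (Adj adj) y b S ∧ l = P ++ (M ++ S) ∧ H = a :: (P ++ (M' ++ S)) := by
  obtain ⟨P, M, M', S, J, hf, hc, h₁, h₂, h₃, h₄, h₅, h₆, h₇, rfl⟩ := h
  obtain ⟨x, M, rfl⟩ := List.exists_cons_of_ne_nil h₁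
  obtain ⟨x', M', rfl⟩ := List.exists_cons_of_ne_nil h₂
  obtain rfl : x = x' := by simpa using h₃
  obtain ⟨y, hy⟩ : ∃ y, (x :: M).getLast? = some y :=
    Option.isSome_iff_exists.1 (by simp)
  have hM := Walk.of_isChain h₅ hy
  have hM' := Walk.of_isChain h₆ (h₄.symm.trans hy)
  have key : ∀ P, l = P ++ (M ++ S) → (∀ z, Walk (Adj adj) a z P → z = x) →
      Walk (Adj adj) a x P ∧ Walk (Adj adj) y b S := by
    rintro P rfl hP
    obtain ⟨z, hz, hz'⟩ := hl.of_append
    obtain rfl := hP z hz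
    obtain ⟨w, hw, hw'⟩ := hz'.of_append
    obtain rfl := hw.end_unique hM
    exact ⟨hz, hw'⟩
  cases P with
  | nil =>
    simp only [List.nil_append, List.cons_append, List.cons.injEq] at h₇
    obtain ⟨rfl, hl'⟩ := h₇
    have := key [] hl' (fun z hz => by cases hz; rfl)
    exact ⟨[], M, M', S, J, a, y, hf, hc, this.1, hM, hM', this.2, hl', by simp⟩
  | cons a' P =>
    simp only [List.append_assoc, List.cons_append, List.cons.injEq] at h₇
    obtain ⟨rfl, hl'⟩ := h₇
    have := key (P ++ [x]) (by simpa using hl') (fun z hz => by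
      obtain ⟨w, -, hw⟩ := hz.of_append
      cases hw with | cons _ hw => cases hw; rfl)
    exact ⟨P ++ [x], M, M', S, J, x, y, hf, hc, this.1, hM, hM', this.2, by simpa using hl',
      by simp⟩

theorem Walk.exists_inverse (hsymm : ∀ i c d, adj i c d → adj i d c)
    (hl : Walk (Adj adj) a b l) :
    ∃ m, Walk (Adj adj) b a m ∧ Homotopic adj (b :: (m ++ l)) [b] := by
  induction hl with
  | nil a => exact ⟨[], .nil a, .refl⟩
  | @cons a a' b l hr _ ih =>
    obtain ⟨m, hm, hh⟩ := ih
    obtain ⟨i, hi⟩ := hr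
    have hi' := hsymm i _ _ hi
    refine ⟨m ++ [a], hm.append (.single ⟨i, hi'⟩), ?_⟩
    have h₁ : Homotopic adj (a' :: [a, a']) [a'] :=
      .of_walk (J := {i}) (b := a') (Set.finite_singleton i) (by simp)
        (.cons ⟨i, rfl, hi'⟩ (.single ⟨i, rfl, hi⟩)) (.nil a')
    have h₂ := (h₁.append_right l).append_left hm
    simp only [List.append_assoc, List.cons_append, List.nil_append] at h₂ ⊢
    exact h₂.trans hh

/-- In a simply connected chamber system, galleries with the same end points are homotopic. -/
theorem SimplyConnected.homotopic (hsymm : ∀ i c d, adj i c d → adj i d c)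
    (hsc : SimplyConnected adj) (hl : Walk (Adj adj) a b l) (hl' : Walk (Adj adj) a b l') :
    Homotopic adj (a :: l) (a :: l') := by
  obtain ⟨m, hm, hh⟩ := hl'.exists_inverse hsymm
  have hlm := hl.append hm
  obtain ⟨c, hc, hnull⟩ := hsc.2 (a :: (l ++ m)) ⟨by simp, hlm.isChain⟩
    (by rw [hlm.getLast?_eq]; rfl)
  obtain rfl : a = c := by simpa using hc
  have h₁ := hh.append_left hl
  have h₂ := Homotopic.append_right (l' := []) hnull l'
  simp only [List.append_nil, List.nil_append, List.append_assoc] at h₁ h₂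
  exact h₁.symm.trans h₂

end Homotopy

section Opposites

variable {T : TwinCS.{u, v} I}

/-- The chamber of `Opp(𝒞)` given by two opposite chambers. -/
abbrev TwinCS.pair (T : TwinCS.{u, v} I) {x : T.Cp} {y : T.Cm} (h : T.op x y) : OppC T :=
  Subtype.mk (x, y) h

/-- `Lift a b p l`: the gallery `a :: l` in `Opp(𝒞)` ends in `b`, changes the component in `𝒞₊`
only in steps that fix the component in `𝒞₋`, and those steps project to the gallery
`a⁺ :: p`. -/
inductive Lift : OppC T → OppC T → List T.Cp → List (OppC T) → Prop
  | nil (a : OppC T) : Lift a a [] []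
  | vert {i : I} {a a' b : OppC T} {p : List T.Cp} {l : List (OppC T)} :
      oppAdj T i a a' → a'.1.1 = a.1.1 → Lift a' b p l → Lift a b p (a' :: l)
  | hor {i : I} {a a' b : OppC T} {p : List T.Cp} {l : List (OppC T)} :
      oppAdj T i a a' → a'.1.2 = a.1.2 → Lift a' b p l → Lift a b (a'.1.1 :: p) (a' :: l)

namespace Lift

variable {a b c : OppC T} {p q : List T.Cp} {l l' m : List (OppC T)}

theorem append (h : Lift a b p l) (h' : Lift b c q m) : Lift a c (p ++ q) (l ++ m) := by
  induction h with
  | nil => exact h'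
  | vert h₁ h₂ _ ih => exact .vert h₁ h₂ (ih h')
  | hor h₁ h₂ _ ih => exact .hor h₁ h₂ (ih h')

theorem walk (h : Lift a b p l) : Walk (Adj (oppAdj T)) a b l := by
  induction h with
  | nil => exact .nil _
  | vert h _ _ ih => exact .cons ⟨_, h⟩ ih
  | hor h _ _ ih => exact .cons ⟨_, h⟩ ih

theorem walk_plus (h : Lift a b p l) : Walk (Adj T.adjp) a.1.1 b.1.1 p := by
  induction h with
  | nil => exact .nil _
  | vert _ h _ ih => exact h ▸ ih
  | hor h _ _ ih => exact .cons ⟨_, h.1⟩ ih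

theorem walk_minus (h : Lift a b p l) :
    Walk (Adj T.adjm) a.1.2 b.1.2 (l.map fun c => c.1.2) := by
  induction h with
  | nil => exact .nil _
  | vert h _ _ ih => exact .cons ⟨_, h.2⟩ ih
  | hor h _ _ ih => exact .cons ⟨_, h.2⟩ ih

theorem plus_eq (h : Lift a b [] l) : ∀ c ∈ a :: l, c.1.1 = a.1.1 := by
  generalize hp : ([] : List T.Cp) = p at h
  induction h with
  | nil => simp
  | vert _ h₁ _ ih =>
    intro c hc
    rcases List.mem_cons.1 hc with rfl | hc
    · rfl
    · exact (ih hp c hc).trans h₁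
  | hor => cases hp

/-- Galleries in `{x} × x^op` with the same end points are homotopic in `Opp(𝒞)`. -/
theorem homotopic_of_nil (hT : SimplyConnected T.adjm) (h : Lift a b [] l)
    (h' : Lift a b [] l') : Homotopic (oppAdj T) (a :: l) (a :: l') := by
  obtain ⟨ω, hω, hop, hconst⟩ := T.tcs4p a.1.1
  have hm := hT.homotopic (fun i _ _ => (T.eqvm i).symm) h.walk_minus h'.walk_minus
  have hmap := hm.map (adj' := oppAdj T) (fun y => T.pair (hop y))
    (fun i c d hcd => ⟨hω i c d hcd, hcd⟩)
  have key : ∀ l, Lift a b [] l →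
      List.map (fun y => T.pair (hop y)) (a.1.2 :: l.map fun c => c.1.2) = a :: l := by
    intro l h
    rw [← List.map_cons (f := fun c : OppC T => c.1.2), List.map_map]
    refine (List.map_congr_left fun c hc => ?_).trans (List.map_id _)
    exact Subtype.ext (Prod.ext
      ((hconst _ (h.plus_eq c hc ▸ c.2)).trans (h.plus_eq c hc).symm) rfl)
  rwa [key l h, key l' h'] at hmap

theorem cons_split {x : T.Cp} (h : Lift a b (x :: p) l) :
    ∃ v a₁ a₂ m, Lift a a₁ [] v ∧ a₂.1.1 = x ∧ a₂.1.2 = a₁.1.2 ∧ Adj (oppAdj T) a₁ a₂ ∧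
      Lift a₂ b p m ∧ l = v ++ a₂ :: m := by
  generalize hp : x :: p = q at h
  induction h with
  | nil => cases hp
  | vert h₁ h₂ _ ih =>
    obtain ⟨v, a₁, a₂, m, hv, hx, hy, hadj, hm, rfl⟩ := ih hp
    exact ⟨_ :: v, a₁, a₂, m, .vert h₁ h₂ hv, hx, hy, hadj, hm, rfl⟩
  | @hor _ a a' b p l h₁ h₂ h _ =>
    cases hp
    exact ⟨[], a, a', l, .nil a, rfl, h₂, ⟨_, h₁⟩, h, rfl⟩

/-- Paths in `x^op` give galleries in `{x} × x^op`. -/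
theorem exists_of_reflTransGen {J : Set I} {x : T.Cp} {y y' : T.Cm} (hy : T.op x y)
    (hy' : T.op x y')
    (h : Relation.ReflTransGen (fun u w => T.op x u ∧ T.op x w ∧ JAdj T.adjm J u w) y y') :
    ∃ l, Lift (T.pair hy) (T.pair hy') [] l ∧
      Walk (JAdj (oppAdj T) J) (T.pair hy) (T.pair hy') l := by
  induction h using Relation.ReflTransGen.head_induction_on with
  | refl => exact ⟨[], .nil _, .nil _⟩
  | @head y z hyz _ ih =>
    obtain ⟨_, hz, j, hj, hadj⟩ := hyz
    obtain ⟨l, hl, hw⟩ := ih hz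
    have hadj' : oppAdj T j (T.pair hy) (T.pair hz) := ⟨(T.eqvp j).refl x, hadj⟩
    exact ⟨T.pair hz :: l, .vert hadj' rfl hl, .cons ⟨j, hj, hadj'⟩ hw⟩

theorem exists_nil {x : T.Cp} {y y' : T.Cm} (hy : T.op x y) (hy' : T.op x y') :
    ∃ l, Lift (T.pair hy) (T.pair hy') [] l := by
  obtain ⟨l, hl, -⟩ := exists_of_reflTransGen (J := Set.univ) hy hy'
    (Relation.ReflTransGen.mono (fun _ _ h => ⟨h.1, h.2.1, h.2.2.jAdj_univ⟩) _ _
      (T.tcs3p x y y' hy hy'))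
  exact ⟨l, hl⟩

/-- Every `J`-gallery in `𝒞₊` lifts to a `J`-gallery in `Opp(𝒞)`. -/
theorem exists_of_walk {J : Set I} {x x' : T.Cp} {y : T.Cm} (hp : Walk (JAdj T.adjp J) x x' p)
    (hy : T.op x y) :
    ∃ (y' : T.Cm) (hy' : T.op x' y') (l : List (OppC T)),
      Lift (T.pair hy) (T.pair hy') p l ∧
        Walk (JAdj (oppAdj T) J) (T.pair hy) (T.pair hy') l := by
  induction hp generalizing y with
  | nil => exact ⟨y, hy, [], .nil _, .nil _⟩
  | @cons x x₁ x' p hx _ ih =>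
    obtain ⟨j, hj, hx⟩ := hx
    obtain ⟨z, hyz, hxz, hx₁z⟩ := T.tcs2p j x x₁ y hx hy
    obtain ⟨y', hy', l, hl, hw⟩ := ih hx₁z
    have h₁ : oppAdj T j (T.pair hy) (T.pair hxz) := ⟨(T.eqvp j).refl x, hyz⟩
    have h₂ : oppAdj T j (T.pair hxz) (T.pair hx₁z) := ⟨hx, (T.eqvm j).refl z⟩
    exact ⟨y', hy', T.pair hxz :: T.pair hx₁z :: l,
      .vert h₁ rfl (.hor h₂ rfl hl), .cons ⟨j, hj, h₁⟩ (.cons ⟨j, hj, h₂⟩ hw)⟩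

/-- A step `x ∼ᵢ x'` in `𝒞₊` can be lifted at any chamber opposite to both `x` and `x'`, with
the same result up to homotopy. -/
theorem exists_square {x x' : T.Cp} {y z : T.Cm} (hx : Adj T.adjp x x') (hxy : T.op x y)
    (hxy' : T.op x' y) (hxz : T.op x z) (hxz' : T.op x' z) :
    ∃ v w, Lift (T.pair hxy) (T.pair hxz) [] v ∧ Lift (T.pair hxy') (T.pair hxz') [] w ∧
      Homotopic (oppAdj T) (T.pair hxy :: (v ++ [T.pair hxz']))
        (T.pair hxy :: T.pair hxy' :: w) := by
  obtain ⟨i, hi⟩ := hx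
  suffices H : ∀ t, T.op x t → ∀ z (hxz : T.op x z) (hxz' : T.op x' z), T.adjm i t z →
      ∃ v w, Lift (T.pair hxy) (T.pair hxz) [] v ∧ Lift (T.pair hxy') (T.pair hxz') [] w ∧
        Homotopic (oppAdj T) (T.pair hxy :: (v ++ [T.pair hxz']))
          (T.pair hxy :: T.pair hxy' :: w) from
    H z hxz z hxz hxz' ((T.eqvm i).refl z)
  intro t ht
  induction T.tcs3p x y t hxy ht with
  | refl =>
    intro z hxz hxz' hyz
    have h₁ : oppAdj T i (T.pair hxy) (T.pair hxz) := ⟨(T.eqvp i).refl x, hyz⟩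
    have h₂ : oppAdj T i (T.pair hxy') (T.pair hxz') := ⟨(T.eqvp i).refl x', hyz⟩
    have h₃ : oppAdj T i (T.pair hxy) (T.pair hxy') := ⟨hi, (T.eqvm i).refl y⟩
    have h₄ : oppAdj T i (T.pair hxz) (T.pair hxz') := ⟨hi, (T.eqvm i).refl z⟩
    exact ⟨[T.pair hxz], [T.pair hxz'], .vert h₁ rfl (.nil _), .vert h₂ rfl (.nil _),
      .of_walk (J := {i}) (Set.finite_singleton i) (by simp)
        (.cons ⟨i, rfl, h₁⟩ (.single ⟨i, rfl, h₄⟩)) (.cons ⟨i, rfl, h₃⟩ (.single ⟨i, rfl, h₂⟩))⟩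
  | @tail s t _ hst ih =>
    intro z hxz hxz' htz
    obtain ⟨hs, ht, j, hj⟩ := hst
    obtain ⟨z₀, hsz₀, hxz₀, hxz₀'⟩ := T.tcs2p i x x' s hi hs
    obtain ⟨v, w, hv, hw, hvw⟩ := ih hs z₀ hxz₀ hxz₀' hsz₀
    have hfin : ({i, j} : Set I).Finite := Set.toFinite _
    have hcard : ({i, j} : Set I).ncard ≤ 2 := (Set.ncard_insert_le i {j}).trans (by simp)
    have hii : i ∈ ({i, j} : Set I) := Or.inl rfl
    have hjj : j ∈ ({i, j} : Set I) := Or.inr rfl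
    obtain ⟨u, hu, hu'⟩ := exists_of_reflTransGen hxz₀' hxz' <|
      T.tcs3pJ x' {i, j} hfin hcard z₀ z hxz₀' hxz' <|
        .head ⟨i, hii, (T.eqvm i).symm hsz₀⟩ <| .head ⟨j, hjj, hj⟩ <| .single ⟨i, hii, htz⟩
    have h₁ : oppAdj T i (T.pair hxz₀) (T.pair hs) :=
      ⟨(T.eqvp i).refl x, (T.eqvm i).symm hsz₀⟩
    have h₂ : oppAdj T j (T.pair hs) (T.pair ht) := ⟨(T.eqvp j).refl x, hj⟩
    have h₃ : oppAdj T i (T.pair ht) (T.pair hxz) := ⟨(T.eqvp i).refl x, htz⟩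
    have h₄ : oppAdj T i (T.pair hxz) (T.pair hxz') := ⟨hi, (T.eqvm i).refl z⟩
    have h₅ : oppAdj T i (T.pair hxz₀) (T.pair hxz₀') := ⟨hi, (T.eqvm i).refl z₀⟩
    refine ⟨v ++ [T.pair hs, T.pair ht, T.pair hxz], w ++ u,
      hv.append (.vert h₁ rfl <| .vert h₂ rfl <| .vert h₃ rfl <| .nil _),
      hw.append hu, ?_⟩
    have hJ : Homotopic (oppAdj T)
        (T.pair hxz₀ :: [T.pair hs, T.pair ht, T.pair hxz, T.pair hxz'])
        (T.pair hxz₀ :: T.pair hxz₀' :: u) :=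
      .of_walk hfin hcard
        (.cons ⟨i, hii, h₁⟩ <| .cons ⟨j, hjj, h₂⟩ <| .cons ⟨i, hii, h₃⟩ <| .single ⟨i, hii, h₄⟩)
        (.cons ⟨i, hii, h₅⟩ hu')
    have hJ' := hJ.append_left hv.walk
    have hvwu := hvw.append_right u
    simp only [List.append_assoc, List.cons_append, List.nil_append] at hvwu ⊢
    exact hJ'.trans hvwu

/-- Two lifts of the same gallery with the same end points are homotopic. -/
theorem homotopic (hT : SimplyConnected T.adjm) (h : Lift a b p l) (h' : Lift a b p l') :
    Homotopic (oppAdj T) (a :: l) (a :: l') := by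
  induction p generalizing a l l' with
  | nil => exact h.homotopic_of_nil hT h'
  | cons x' p ih =>
    obtain ⟨v, ⟨⟨x, y⟩, hxy⟩, ⟨⟨_, _⟩, hxy'⟩, m, hv, rfl, rfl, hadj, hm, rfl⟩ := h.cons_split
    obtain ⟨v', ⟨⟨x₂, z⟩, hxz⟩, ⟨⟨_, _⟩, hxz'⟩, m', hv', rfl, rfl, -, hm', rfl⟩ :=
      h'.cons_split
    have hx : x = a.1.1 := hv.plus_eq _ (List.mem_of_getLast? hv.walk.getLast?_eq)
    have hx₂ : x₂ = a.1.1 := hv'.plus_eq _ (List.mem_of_getLast? hv'.walk.getLast?_eq)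
    obtain rfl : x = x₂ := hx.trans hx₂.symm
    obtain ⟨i, hi⟩ := hadj
    obtain ⟨u, w, hu, hw, huw⟩ := exists_square ⟨i, hi.1⟩ hxy hxy' hxz hxz'
    have h₁ := (ih hm (hw.append hm')).append_left
      (hv.walk.append (.single (r := Adj (oppAdj T)) ⟨i, hi⟩))
    have h₂ := (huw.append_right m').append_left hv.walk
    have h₃ := ((hv.append hu).homotopic_of_nil hT hv').append_right (T.pair hxz' :: m')
    simp only [List.append_assoc, List.cons_append, List.nil_append] at h₁ h₂ h₃
    exact (h₁.trans h₂.symm).trans h₃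

/-- Every gallery in `Opp(𝒞)` is homotopic to a lift. -/
theorem exists_homotopic (h : Walk (Adj (oppAdj T)) a b l) :
    ∃ p l', Lift a b p l' ∧ Homotopic (oppAdj T) (a :: l) (a :: l') := by
  induction h with
  | nil a => exact ⟨[], [], .nil a, .refl⟩
  | @cons a a' b l hadj _ ih =>
    obtain ⟨p, l', hl', hh⟩ := ih
    obtain ⟨⟨x, y⟩, hxy⟩ := a
    obtain ⟨⟨x', y'⟩, hxy'⟩ := a'
    obtain ⟨i, hi⟩ := hadj
    obtain ⟨z, hyz, hxz, hxz'⟩ := T.tcs2p i x x' y hi.1 hxy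
    have h₁ : oppAdj T i (T.pair hxy) (T.pair hxz) := ⟨(T.eqvp i).refl x, hyz⟩
    have h₂ : oppAdj T i (T.pair hxz) (T.pair hxz') := ⟨hi.1, (T.eqvm i).refl z⟩
    have h₃ : oppAdj T i (T.pair hxz') (T.pair hxy') :=
      ⟨(T.eqvp i).refl x', (T.eqvm i).trans ((T.eqvm i).symm hyz) hi.2⟩
    refine ⟨x' :: p, T.pair hxz :: T.pair hxz' :: T.pair hxy' :: l',
      .vert h₁ rfl (.hor h₂ rfl (.vert h₃ rfl hl')), ?_⟩
    have hstep : Homotopic (oppAdj T) (T.pair hxy :: [T.pair hxy'])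
        (T.pair hxy :: [T.pair hxz, T.pair hxz', T.pair hxy']) :=
      .of_walk (J := {i}) (Set.finite_singleton i) (by simp) (.single ⟨i, rfl, hi⟩)
        (.cons ⟨i, rfl, h₁⟩ (.cons ⟨i, rfl, h₂⟩ (.single ⟨i, rfl, h₃⟩)))
    exact (hh.append_left (.single (r := Adj (oppAdj T)) ⟨i, hi⟩)).trans
      (hstep.append_right _)

/-- Homotopies in `𝒞₊` lift to `Opp(𝒞)`. -/
theorem exists_of_homotopic (hT : SimplyConnected T.adjm) {H : List T.Cp} (h : Lift a b p l)
    (hH : Homotopic T.adjp (a.1.1 :: p) H) :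
    ∃ q m, H = a.1.1 :: q ∧ Lift a b q m ∧ Homotopic (oppAdj T) (a :: l) (a :: m) := by
  induction hH with
  | refl => exact ⟨p, l, rfl, h, .refl⟩
  | tail _ hstep ih =>
    obtain ⟨q, m, rfl, hm, hlm⟩ := ih
    obtain ⟨P, M, M', S, J, x, x', hf, hc, hP, hM, hM', hS, rfl, rfl⟩ :=
      hstep.exists_walk hm.walk_plus
    obtain ⟨⟨a₁, a₂⟩, ha⟩ := a
    obtain ⟨⟨b₁, b₂⟩, hb⟩ := b
    obtain ⟨y, hy, lP, hlP, -⟩ := exists_of_walk (hP.mono fun _ _ => Adj.jAdj_univ) ha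
    obtain ⟨z, hz, lM, hlM, hwM⟩ := exists_of_walk hM hy
    obtain ⟨z', hz', lM', hlM', hwM'⟩ := exists_of_walk hM' hy
    obtain ⟨w, hw, lS, hlS, -⟩ := exists_of_walk (hS.mono fun _ _ => Adj.jAdj_univ) hz
    obtain ⟨lb, hlb⟩ := exists_nil hw hb
    have key := Relation.ReflTransGen.lift (r := JAdj (oppAdj T) J) (p := JAdj T.adjm J)
      (fun c : OppC T => c.1.2) fun _ _ ⟨j, hj, h⟩ => ⟨j, hj, h.2⟩
    have hres : InResidue T.adjm J z' z :=
      have : Std.Symm (JAdj T.adjm J) := ⟨fun _ _ ⟨j, hj, h⟩ => ⟨j, hj, (T.eqvm j).symm h⟩⟩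
      (Std.Symm.symm (r := Relation.ReflTransGen (JAdj T.adjm J)) _ _
        (key _ _ hwM'.reflTransGen)).trans
        (key _ _ hwM.reflTransGen)
    obtain ⟨u, hu, hwu⟩ := exists_of_reflTransGen hz' hz (T.tcs3pJ x' J hf hc z' z hz' hz hres)
    have hl₁ := hlP.append (hlM.append (hlS.append hlb))
    have hl₂ := hlP.append ((hlM'.append hu).append (hlS.append hlb))
    simp only [List.append_nil] at hl₁ hl₂
    exact ⟨_, _, rfl, hl₂, (hlm.trans (hm.homotopic hT hl₁)).trans
      (((Homotopic.of_walk hf hc hwM (hwM'.append hwu)).append_right _).append_left hlP.walk)⟩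

end Lift

/-- Every closed gallery in `Opp(𝒞)` is null-homotopic if `𝒞` is simply connected. -/
theorem TwinSC.nullHomotopic (hT : TwinSC T) {c : OppC T} {l : List (OppC T)}
    (h : Walk (Adj (oppAdj T)) c c l) : NullHomotopic (oppAdj T) (c :: l) := by
  obtain ⟨p, l', hl', hh⟩ := Lift.exists_homotopic h
  have hp := hT.1.homotopic (fun i _ _ => (T.eqvp i).symm) hl'.walk_plus (.nil c.1.1)
  obtain ⟨q, m, hq, hm, hlm⟩ := hl'.exists_of_homotopic hT.2 hp
  obtain rfl : [] = q := by simpa using hq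
  exact ⟨c, rfl, (hh.trans hlm).trans (hm.homotopic hT.2 (.nil c))⟩

end Opposites

/-- Let `𝒞` be a simply connected twin chamber system, `J ⊆ I` with `|J| ≤ 2`,
and `c` a chamber of `Opp(𝒞)`. Every closed gallery in `Opp(𝒞)` based at `c` whose chambers all
have `𝒞₊`-component in the `J`-residue of `c⁺` is null-homotopic in `Opp(𝒞)`. -/
theorem nullHomotopic_of_plus_in_residue {I : Type u} (T : TwinCS.{u, v} I) (hT : TwinSC T)
    (J : Set I) (hJfin : J.Finite) (hJ2 : J.ncard ≤ 2)
    (c : OppC T) (G : List (OppC T))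
    (hG : IsGallery (oppAdj T) G)
    (hhead : G.head? = some c) (hlast : G.getLast? = some c)
    (hres : ∀ u ∈ G, InResidue T.adjp J c.1.1 u.1.1) :
    NullHomotopic (oppAdj T) G := by
  obtain ⟨a, l, rfl⟩ := List.exists_cons_of_ne_nil hG.1
  obtain rfl : a = c := by simpa using hhead
  exact hT.nullHomotopic (.of_isChain hG.2 hlast)

end TwinChamber
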